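/- Let N be square-free and ρ = (N₀, N₁, N₂), ρ′ = (N₀′, N₁′, N₂′) two multiplicative partitions of N (N₀N₁N₂ = N = N₀′N₁′N₂′). Let (M_ρ I) and (M_{ρ′} I) be coprime symmetric pairs where M_ρ is diagonal with M_ρ ≡ 0 mod q for q | N₀, M_ρ ≡ diag(1,0) mod q for q | N₁, M_ρ ≡ I mod q for q | N₂ (similarly for ρ′). Then the GL₂(ℤ)-equivalence classes of (M_ρ I) and (M_{ρ′} I) lie in the same right Γ₀(N)-orbit (under (M N) ↦ (M N)γ, γ ∈ Γ₀(N) ⊂ Sp₄(ℤ)) if and only if ρ = ρ′; more generally, for square-free N, two coprime symmetric pairs (M N), (M′ N′) lie in the same orbit iff rank_q M = rank_q M′ for all primes q | N. -/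

import Mathlib

open Matrix

/-- The standard symplectic form matrix `J = [[0,I₂],[-I₂,0]]`. -/
def Jmat : Matrix (Fin 2 ⊕ Fin 2) (Fin 2 ⊕ Fin 2) ℤ :=
  Matrix.fromBlocks 0 1 (-1) 0

/-- `γ ∈ Sp₄(ℤ)`. -/
def IsSp4 (γ : Matrix (Fin 2 ⊕ Fin 2) (Fin 2 ⊕ Fin 2) ℤ) : Prop :=
  γᵀ * Jmat * γ = Jmat

/-- `γ ∈ Γ₀(N)`: symplectic with lower-left block `≡ 0 mod N`. -/
def InGamma0 (N : ℕ) (γ : Matrix (Fin 2 ⊕ Fin 2) (Fin 2 ⊕ Fin 2) ℤ) : Prop :=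
  IsSp4 γ ∧ ∀ i j, (N : ℤ) ∣ γ.toBlocks₂₁ i j

/-- The 2×4 matrix `(M N)` reduced mod `p`. -/
def concatMod (p : ℕ) (M N : Matrix (Fin 2) (Fin 2) ℤ) :
    Matrix (Fin 2) (Fin 2 ⊕ Fin 2) (ZMod p) :=
  Matrix.of fun i => Sum.elim (fun j => ((M i j : ℤ) : ZMod p))
    (fun j => ((N i j : ℤ) : ZMod p))

/-- `(M N)` is a coprime symmetric pair. -/
def IsCSPair (M N : Matrix (Fin 2) (Fin 2) ℤ) : Prop :=
  M * Nᵀ = N * Mᵀ ∧ ∀ p : ℕ, p.Prime → (concatMod p M N).rank = 2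

/-- The `GL₂(ℤ)`-classes of `(M N)` and `(M' N')` lie in the same right
`Γ₀(L)`-orbit, via the bottom-row action `(M N) ↦ G·((M N)·γ)`. -/
def SameOrbit (L : ℕ) (M N M' N' : Matrix (Fin 2) (Fin 2) ℤ) : Prop :=
  ∃ γ : Matrix (Fin 2 ⊕ Fin 2) (Fin 2 ⊕ Fin 2) ℤ, InGamma0 L γ ∧
    ∃ G : Matrix (Fin 2) (Fin 2) ℤ, IsUnit G.det ∧
      M' = G * (M * γ.toBlocks₁₁ + N * γ.toBlocks₂₁) ∧
      N' = G * (M * γ.toBlocks₁₂ + N * γ.toBlocks₂₂)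

/-- `Mρ` is the diagonal matrix attached to the multiplicative partition
`(N₀,N₁,N₂)`: `Mρ ≡ 0` mod primes dividing `N₀`, `Mρ ≡ diag(1,0)` mod primes
dividing `N₁`, and `Mρ ≡ I` mod primes dividing `N₂`. -/
def IsPartitionMatrix (N₀ N₁ N₂ : ℕ) (Mρ : Matrix (Fin 2) (Fin 2) ℤ) : Prop :=
  Mρ.IsDiag ∧
  (∀ q : ℕ, q.Prime → q ∣ N₀ → ∀ i j, (q : ℤ) ∣ Mρ i j) ∧
  (∀ q : ℕ, q.Prime → q ∣ N₁ → ∀ i j, (q : ℤ) ∣ ((Mρ - !![1,0;0,0] : Matrix (Fin 2) (Fin 2) ℤ) i j)) ∧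
  (∀ q : ℕ, q.Prime → q ∣ N₂ → ∀ i j, (q : ℤ) ∣ ((Mρ - 1 : Matrix (Fin 2) (Fin 2) ℤ) i j))

theorem exists_isCoprime_add_mul {c d n : ℤ} (hc : c ≠ 0)
    (h : ∀ p : ℕ, p.Prime → (p : ℤ) ∣ c → (p : ℤ) ∣ d → ¬ (p : ℤ) ∣ n) :
    ∃ t, IsCoprime c (d + t * n) := by
  classical
  set P : Finset ℕ := c.natAbs.primeFactors.filter (fun p : ℕ => ¬ (p : ℤ) ∣ d) with hP
  refine ⟨∏ p ∈ P, (p : ℤ), ?_⟩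
  rw [Int.isCoprime_iff_gcd_eq_one, ← Int.natAbs_one]
  by_contra hne
  obtain ⟨p, hp, hpd⟩ := Nat.exists_prime_and_dvd hne
  have hpc : (p : ℤ) ∣ c := (Int.natCast_dvd_natCast.2 hpd).trans (Int.gcd_dvd_left _ _)
  have hps : (p : ℤ) ∣ d + (∏ p ∈ P, (p : ℤ)) * n :=
    (Int.natCast_dvd_natCast.2 hpd).trans (Int.gcd_dvd_right _ _)
  have hpZ : Prime (p : ℤ) := Nat.prime_iff_prime_int.1 hp
  by_cases hd : (p : ℤ) ∣ d
  · rcases hpZ.dvd_or_dvd ((dvd_add_right hd).1 hps) with h1 | h1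
    · obtain ⟨q, hq, hpq⟩ := (hpZ.dvd_finsetProd_iff _).1 h1
      rw [hP, Finset.mem_filter] at hq
      have : p = q := (Nat.prime_dvd_prime_iff_eq hp (Nat.prime_of_mem_primeFactors hq.1)).1
        (Int.natCast_dvd_natCast.1 hpq)
      exact hq.2 (this ▸ hd)
    · exact h p hp hpc hd h1
  · have hmem : p ∈ P := by
      rw [hP, Finset.mem_filter, Nat.mem_primeFactors]
      exact ⟨⟨hp, Int.natCast_dvd.1 hpc, by simpa using hc⟩, hd⟩
    exact hd ((dvd_add_left ((Finset.dvd_prod_of_mem _ hmem).mul_right n)).1 hps)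

/-- Reduction modulo `n` is surjective on `SL₂`. -/
theorem exists_det_eq_one_map_eq {n : ℕ} (hn : n ≠ 0) (g : Matrix (Fin 2) (Fin 2) (ZMod n))
    (hg : g.det = 1) :
    ∃ G : Matrix (Fin 2) (Fin 2) ℤ, G.det = 1 ∧ G.map (Int.castRingHom (ZMod n)) = g := by
  have hnZ : (n : ℤ) ≠ 0 := by exact_mod_cast hn
  obtain ⟨a, ha⟩ := ZMod.intCast_surjective (g 0 0)
  obtain ⟨b, hb⟩ := ZMod.intCast_surjective (g 0 1)
  obtain ⟨c, hc0, hc⟩ : ∃ c : ℤ, c ≠ 0 ∧ (c : ZMod n) = g 1 0 := by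
    obtain ⟨c, hc⟩ := ZMod.intCast_surjective (g 1 0)
    by_cases h : c = 0
    · exact ⟨n, hnZ, by simp [← hc, h]⟩
    · exact ⟨c, h, hc⟩
  obtain ⟨d, hd⟩ := ZMod.intCast_surjective (g 1 1)
  rw [det_fin_two, ← ha, ← hb, ← hc, ← hd] at hg
  have hdvd : (n : ℤ) ∣ a * d - b * c - 1 := by
    rw [← ZMod.intCast_zmod_eq_zero_iff_dvd _ n]
    push_cast
    rw [hg, sub_self]
  obtain ⟨t, u, v, huv⟩ := exists_isCoprime_add_mul (n := (n : ℤ)) (d := d) hc0 (by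
    intro p hp hpc hpd hpn
    have h1 : (p : ℤ) ∣ 1 := by
      have := (hpd.mul_left a).sub (hpc.mul_left b) |>.sub (hpn.trans hdvd)
      simpa using this
    exact (Nat.prime_iff_prime_int.1 hp).not_isUnit (isUnit_of_dvd_one h1))
  set e := d + t * n with he
  have hec : (e : ZMod n) = d := by simp [he]
  have huv' : (u : ZMod n) * c + v * d = 1 := by
    rw [← hec]
    exact_mod_cast congrArg (Int.cast : ℤ → ZMod n) huv
  -- the row `(v, -u)` completes `(c, e)`; shift it by a multiple of `(c, e)`
  refine ⟨!![v + (b * v + a * u) * c, -u + (b * v + a * u) * e; c, e], ?_, ?_⟩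
  · rw [det_fin_two_of]
    linear_combination huv
  · ext i j
    fin_cases i <;> fin_cases j
    · simp only [Fin.zero_eta, map_apply, ← ha]
      simp
      linear_combination (-v : ZMod n) * hg + (a : ZMod n) * huv'
    · simp only [map_apply]
      simp [hec, ← hb]
      linear_combination (u : ZMod n) * hg + (b : ZMod n) * huv'
    · simpa using hc
    · simpa [hec] using hd

/-- Equivalence of pairs under `SL₂` on the left and the Siegel parabolic on the right:
the parabolic element is `[[A, A * S], [0, D]]` with `D = A⁻ᵀ` and `S` symmetric. -/
def ParabolicRel {R : Type*} [CommRing R] (M N M' N' : Matrix (Fin 2) (Fin 2) R) : Prop :=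
  ∃ G A D S : Matrix (Fin 2) (Fin 2) R, G.det = 1 ∧ Aᵀ * D = 1 ∧ Sᵀ = S ∧
    M' = G * M * A ∧ N' = M' * S + G * N * D

namespace ParabolicRel

section CommRing

variable {R : Type*} [CommRing R] {M N M' N' M'' N'' : Matrix (Fin 2) (Fin 2) R}

theorem symm (h : ParabolicRel M N M' N') : ParabolicRel M' N' M N := by
  obtain ⟨G, A, D, S, hG, hAD, hS, hM, hN⟩ := h
  have hAD' : A * Dᵀ = 1 := by
    rw [← transpose_inj, transpose_mul, transpose_transpose, transpose_one]
    exact mul_eq_one_comm.1 hAD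
  have hDA : D * Aᵀ = 1 := mul_eq_one_comm.1 hAD
  have hGG : G.adjugate * G = 1 := by rw [adjugate_mul, hG, one_smul]
  have hM' : M = G.adjugate * M' * Dᵀ := by
    rw [hM, show G.adjugate * (G * M * A) * Dᵀ = (G.adjugate * G) * M * (A * Dᵀ) by
      simp only [Matrix.mul_assoc], hGG, hAD', Matrix.one_mul, Matrix.mul_one]
  refine ⟨G.adjugate, Dᵀ, Aᵀ, -(A * S * Aᵀ), ?_, by simpa using hDA, ?_, hM', ?_⟩
  · rw [det_adjugate, hG, one_pow]
  · simp [transpose_mul, hS, Matrix.mul_assoc]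
  · have h1 : G.adjugate * (M' * S) * Aᵀ = M * (A * S * Aᵀ) := by
      rw [hM, show G.adjugate * (G * M * A * S) * Aᵀ = (G.adjugate * G) * (M * (A * S * Aᵀ)) by
        simp only [Matrix.mul_assoc], hGG, Matrix.one_mul]
    have h2 : G.adjugate * (G * N * D) * Aᵀ = N := by
      rw [show G.adjugate * (G * N * D) * Aᵀ = (G.adjugate * G) * N * (D * Aᵀ) by
        simp only [Matrix.mul_assoc], hGG, hDA, Matrix.one_mul, Matrix.mul_one]
    rw [hN, Matrix.mul_add, Matrix.add_mul, h1, h2, Matrix.mul_neg]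
    abel

theorem trans (h : ParabolicRel M N M' N') (h' : ParabolicRel M' N' M'' N'') :
    ParabolicRel M N M'' N'' := by
  obtain ⟨G, A, D, S, hG, hAD, hS, hM, hN⟩ := h
  obtain ⟨G', A', D', S', hG', hAD', hS', hM', hN'⟩ := h'
  have hAD₂ : A' * D'ᵀ = 1 := by
    rw [← transpose_inj, transpose_mul, transpose_transpose, transpose_one]
    exact mul_eq_one_comm.1 hAD'
  refine ⟨G' * G, A * A', D * D', S' + D'ᵀ * S * D', by rw [det_mul, hG, hG', one_mul], ?_, ?_,
    ?_, ?_⟩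
  · rw [transpose_mul, show A'ᵀ * Aᵀ * (D * D') = A'ᵀ * (Aᵀ * D) * D' by
      simp only [Matrix.mul_assoc], hAD, Matrix.mul_one, hAD']
  · simp [transpose_mul, hS, hS', Matrix.mul_assoc]
  · rw [hM', hM]
    simp only [Matrix.mul_assoc]
  · have h1 : M'' * (D'ᵀ * S * D') = G' * M' * S * D' := by
      rw [hM', show G' * M' * A' * (D'ᵀ * S * D') = G' * M' * (A' * D'ᵀ) * S * D' by
        simp only [Matrix.mul_assoc], hAD₂, Matrix.mul_one]
    rw [Matrix.mul_add, h1, hN', hN]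
    simp only [Matrix.mul_add, Matrix.add_mul, Matrix.mul_assoc]
    abel

theorem mul_transpose_comm (h : ParabolicRel M N M' N') (hMN : M * Nᵀ = N * Mᵀ) :
    M' * N'ᵀ = N' * M'ᵀ := by
  obtain ⟨G, A, D, S, -, hAD, hS, hM, hN⟩ := h
  have hAD' : A * Dᵀ = 1 := by
    rw [← transpose_inj, transpose_mul, transpose_transpose, transpose_one]
    exact mul_eq_one_comm.1 hAD
  have hDA : D * Aᵀ = 1 := mul_eq_one_comm.1 hAD
  have h1 : M' * (G * N * D)ᵀ = G * (M * Nᵀ) * Gᵀ := by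
    rw [hM, transpose_mul, transpose_mul,
      show G * M * A * (Dᵀ * (Nᵀ * Gᵀ)) = G * (M * (A * Dᵀ) * Nᵀ) * Gᵀ by
        simp only [Matrix.mul_assoc], hAD', Matrix.mul_one]
  have h2 : G * N * D * M'ᵀ = G * (N * Mᵀ) * Gᵀ := by
    rw [hM, transpose_mul, transpose_mul,
      show G * N * D * (Aᵀ * (Mᵀ * Gᵀ)) = G * (N * (D * Aᵀ) * Mᵀ) * Gᵀ by
        simp only [Matrix.mul_assoc], hDA, Matrix.mul_one]
  rw [hN, transpose_add, Matrix.mul_add, Matrix.add_mul, h1, h2, hMN, transpose_mul, hS,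
    ← Matrix.mul_assoc M' S]

theorem exists_right_inverse (h : ParabolicRel M N M' N') (hMN : ∃ X Y, M * X + N * Y = 1) :
    ∃ X Y, M' * X + N' * Y = 1 := by
  obtain ⟨G, A, D, S, hG, hAD, hS, hM, hN⟩ := h
  obtain ⟨X, Y, hXY⟩ := hMN
  have hAD' : A * Dᵀ = 1 := by
    rw [← transpose_inj, transpose_mul, transpose_transpose, transpose_one]
    exact mul_eq_one_comm.1 hAD
  have hDA : D * Aᵀ = 1 := mul_eq_one_comm.1 hAD
  have hGG : G * G.adjugate = 1 := by rw [mul_adjugate, hG, one_smul]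
  refine ⟨Dᵀ * X * G.adjugate - S * (Aᵀ * Y * G.adjugate), Aᵀ * Y * G.adjugate, ?_⟩
  have h1 : M' * (Dᵀ * X * G.adjugate) = G * (M * X) * G.adjugate := by
    rw [hM, show G * M * A * (Dᵀ * X * G.adjugate) = G * (M * (A * Dᵀ) * X) * G.adjugate by
      simp only [Matrix.mul_assoc], hAD', Matrix.mul_one]
  have h2 : G * N * D * (Aᵀ * Y * G.adjugate) = G * (N * Y) * G.adjugate := by
    rw [show G * N * D * (Aᵀ * Y * G.adjugate) = G * (N * (D * Aᵀ) * Y) * G.adjugate by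
      simp only [Matrix.mul_assoc], hDA, Matrix.mul_one]
  rw [hN, Matrix.mul_sub, Matrix.add_mul, h1, h2, ← Matrix.mul_assoc M' S,
    ← add_assoc, sub_add_cancel, ← Matrix.add_mul, ← Matrix.mul_add, hXY, Matrix.mul_one, hGG]

theorem rank_eq (h : ParabolicRel M N M' N') : M'.rank = M.rank := by
  obtain ⟨G, A, D, S, hG, hAD, -, rfl, -⟩ := h
  have hA : IsUnit A.det := by
    have := congrArg det hAD
    rw [det_mul, det_transpose, det_one] at this
    exact IsUnit.of_mul_eq_one _ this
  rw [rank_mul_eq_left_of_isUnit_det _ _ hA,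
    rank_mul_eq_right_of_isUnit_det _ _ (by rw [hG]; exact isUnit_one)]

/-- Equivalence can be checked after each of a family of projections presenting `R` as a
product. -/
theorem of_forall_map {ι : Type*} {F : ι → Type*} [∀ i, CommRing (F i)] (f : ∀ i, R →+* F i)
    (hf : Function.Bijective fun r i => f i r)
    (h : ∀ i, ParabolicRel (M.map (f i)) (N.map (f i)) (M'.map (f i)) (N'.map (f i))) :
    ParabolicRel M N M' N' := by
  have lift : ∀ X : ∀ i, Matrix (Fin 2) (Fin 2) (F i),
      ∃ Y : Matrix (Fin 2) (Fin 2) R, ∀ i, Y.map (f i) = X i := by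
    intro X
    choose y hy using fun a b => hf.2 (fun i => X i a b)
    exact ⟨Matrix.of y, fun i => by ext a b; exact congrFun (hy a b) i⟩
  have ext' : ∀ X Y : Matrix (Fin 2) (Fin 2) R, (∀ i, X.map (f i) = Y.map (f i)) → X = Y := by
    intro X Y hXY
    ext a b
    exact hf.1 (funext fun i => congrFun (congrFun (hXY i) a) b)
  choose G A D S hG hAD hS hM hN using h
  obtain ⟨G', hG'⟩ := lift G
  obtain ⟨A', hA'⟩ := lift A
  obtain ⟨D', hD'⟩ := lift D
  obtain ⟨S', hS'⟩ := lift S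
  refine ⟨G', A', D', S', hf.1 (funext fun i => ?_), ext' _ _ fun i => ?_, ext' _ _ fun i => ?_,
    ext' _ _ fun i => ?_, ext' _ _ fun i => ?_⟩
  · have := (f i).map_det G'
    rw [RingHom.mapMatrix_apply, hG', hG] at this
    simpa using this
  · rw [Matrix.map_mul, transpose_map, hA', hD', hAD, Matrix.map_one _ (map_zero _) (map_one _)]
  · rw [transpose_map, hS', hS]
  · rw [Matrix.map_mul, Matrix.map_mul, hG', hA', hM]
  · rw [Matrix.map_add _ (map_add _), Matrix.map_mul, Matrix.map_mul, Matrix.map_mul, hG', hS',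
      hD', hN]

end CommRing

section Field

variable {F : Type*} [Field F]

/-- Over a field, a coprime symmetric pair is equivalent to `(E, 1 - E)` with `E` one of
`0`, `diag(1,0)`, `1`. -/
theorem normal_form {M N : Matrix (Fin 2) (Fin 2) F} (hMN : M * Nᵀ = N * Mᵀ)
    (hinv : ∃ X Y, M * X + N * Y = 1) :
    ParabolicRel M N 0 1 ∨ ParabolicRel M N !![1, 0; 0, 0] !![0, 0; 0, 1] ∨
      ParabolicRel M N 1 0 := by
  obtain ⟨l, l', d, hd⟩ := Pivot.exists_list_transvec_mul_mul_list_transvec_eq_diagonal M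
  set G := (l.map TransvectionStruct.toMatrix).prod
  set A := (l'.map TransvectionStruct.toMatrix).prod
  have hG : G.det = 1 := TransvectionStruct.det_toMatrix_prod l
  have hA : A.det = 1 := TransvectionStruct.det_toMatrix_prod l'
  have hrel : ParabolicRel M N (diagonal d) (G * N * A.adjugateᵀ) :=
    ⟨G, A, A.adjugateᵀ, 0, hG, by rw [← transpose_mul, adjugate_mul, hA, one_smul, transpose_one],
      transpose_zero, hd.symm, by rw [Matrix.mul_zero, zero_add]⟩
  have hsymm := hrel.mul_transpose_comm hMN
  obtain ⟨X, Y, hXY⟩ := hrel.exists_right_inverse hinv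
  generalize G * N * A.adjugateᵀ = K at *
  suffices h : ParabolicRel (diagonal d) K 0 1 ∨
      ParabolicRel (diagonal d) K !![1, 0; 0, 0] !![0, 0; 0, 1] ∨
      ParabolicRel (diagonal d) K 1 0 from
    h.imp hrel.trans (Or.imp hrel.trans hrel.trans)
  have hoff : d 0 * K 1 0 = K 0 1 * d 1 := by
    simpa [Matrix.mul_apply, Fin.sum_univ_two, diagonal_apply] using congrFun (congrFun hsymm 0) 1
  have h00 : d 0 * X 0 0 + (K 0 0 * Y 0 0 + K 0 1 * Y 1 0) = 1 := by
    simpa [Matrix.mul_apply, Fin.sum_univ_two, diagonal_apply] using congrFun (congrFun hXY 0) 0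
  have h11 : d 1 * X 1 1 + (K 1 0 * Y 0 1 + K 1 1 * Y 1 1) = 1 := by
    simpa [Matrix.mul_apply, Fin.sum_univ_two, diagonal_apply] using congrFun (congrFun hXY 1) 1
  have hdiag : diagonal d = !![d 0, 0; 0, d 1] := by
    ext i j; fin_cases i <;> fin_cases j <;> simp
  have hK : K = !![K 0 0, K 0 1; K 1 0, K 1 1] := eta_fin_two K
  by_cases h0 : d 0 = 0 <;> by_cases h1 : d 1 = 0
  · left
    have hz : diagonal d = 0 := by rw [hdiag, h0, h1]; ext i j; fin_cases i <;> fin_cases j <;> rfl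
    rw [hz, Matrix.zero_mul, zero_add] at hXY
    exact ⟨1, Kᵀ, Y, 0, det_one, by rw [transpose_transpose, hXY], transpose_zero,
      by rw [hz]; simp, by simp [hXY]⟩
  · right; left
    have hK01 : K 0 1 = 0 := by simpa [h0, h1] using hoff.symm
    have hK00 : K 0 0 ≠ 0 := by rintro h; simp [h0, hK01, h] at h00
    refine ⟨!![0, 1; -1, 0], !![0, -K 0 0; (d 1)⁻¹, 0], !![0, -(K 0 0)⁻¹; d 1, 0],
      !![-(K 1 1 * d 1), K 1 0 * (K 0 0)⁻¹; K 1 0 * (K 0 0)⁻¹, 0], ?_, ?_, ?_, ?_, ?_⟩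
    · simp [det_fin_two_of]
    · ext i j; fin_cases i <;> fin_cases j <;> simp [h1, hK00, Matrix.mul_apply, Fin.sum_univ_two]
    · ext i j; fin_cases i <;> fin_cases j <;> simp
    · rw [hdiag, h0]
      ext i j; fin_cases i <;> fin_cases j <;> simp [h1]
    · rw [hK, hK01]
      ext i j; fin_cases i <;> fin_cases j <;> simp [hK00]
  · right; left
    have hK10 : K 1 0 = 0 := by simpa [h0, h1] using hoff
    have hK11 : K 1 1 ≠ 0 := by rintro h; simp [h1, hK10, h] at h11
    refine ⟨1, !![(d 0)⁻¹, 0; 0, K 1 1], !![d 0, 0; 0, (K 1 1)⁻¹],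
      !![-(K 0 0 * d 0), -(K 0 1 * (K 1 1)⁻¹); -(K 0 1 * (K 1 1)⁻¹), 0], ?_, ?_, ?_, ?_, ?_⟩
    · simp
    · ext i j; fin_cases i <;> fin_cases j <;> simp [h0, hK11, Matrix.mul_apply, Fin.sum_univ_two]
    · ext i j; fin_cases i <;> fin_cases j <;> simp
    · rw [hdiag, h1]
      ext i j; fin_cases i <;> fin_cases j <;> simp [h0]
    · rw [hK, hK10]
      ext i j; fin_cases i <;> fin_cases j <;> simp [hK11]
  · right; right
    refine ⟨1, !![(d 0)⁻¹, 0; 0, (d 1)⁻¹], !![d 0, 0; 0, d 1],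
      -(K * !![d 0, 0; 0, d 1]), ?_, ?_, ?_, ?_, ?_⟩
    · simp
    · ext i j; fin_cases i <;> fin_cases j <;> simp [h0, h1, Matrix.mul_apply, Fin.sum_univ_two]
    · rw [hK]
      ext i j; fin_cases i <;> fin_cases j <;> simp [mul_comm, hoff]
    · rw [hdiag]
      ext i j; fin_cases i <;> fin_cases j <;> simp [h0, h1]
    · simp

theorem rank_diag_one_zero : (!![1, 0; 0, 0] : Matrix (Fin 2) (Fin 2) F).rank = 1 := by
  classical
  have h : (!![1, 0; 0, 0] : Matrix (Fin 2) (Fin 2) F) = diagonal ![1, 0] := by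
    ext i j; fin_cases i <;> fin_cases j <;> simp
  rw [h, rank_diagonal, Fintype.card_subtype]
  simp [Finset.filter, Fin.univ_succ]

theorem of_rank_eq {M N M' N' : Matrix (Fin 2) (Fin 2) F} (hMN : M * Nᵀ = N * Mᵀ)
    (hinv : ∃ X Y, M * X + N * Y = 1) (hMN' : M' * N'ᵀ = N' * M'ᵀ)
    (hinv' : ∃ X Y, M' * X + N' * Y = 1) (hrank : M.rank = M'.rank) :
    ParabolicRel M N M' N' := by
  have r0 : (0 : Matrix (Fin 2) (Fin 2) F).rank = 0 := rank_zero
  have r1 := rank_diag_one_zero (F := F)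
  have r2 : (1 : Matrix (Fin 2) (Fin 2) F).rank = 2 := by simp
  rcases normal_form hMN hinv with h | h | h <;>
  rcases normal_form hMN' hinv' with h' | h' | h' <;>
  first
  | exact h.trans h'.symm
  | (have := h.rank_eq; have := h'.rank_eq; omega)

end Field

end ParabolicRel

/-- An integer matrix of full row rank modulo every prime has a right inverse. -/
theorem exists_mul_eq_one_of_rank_map {m n : Type*} [Fintype m] [DecidableEq m] [Fintype n]
    [DecidableEq n] (W : Matrix m n ℤ)
    (hW : ∀ p : ℕ, p.Prime → (W.map (Int.castRingHom (ZMod p))).rank = Fintype.card m) :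
    ∃ X : Matrix n m ℤ, W * X = 1 := by
  let I : Ideal ℤ :=
    { carrier := {d | ∃ X : Matrix n m ℤ, W * X = d • (1 : Matrix m m ℤ)}
      add_mem' := by
        rintro a b ⟨X, hX⟩ ⟨Y, hY⟩
        exact ⟨X + Y, by rw [Matrix.mul_add, hX, hY, add_smul]⟩
      zero_mem' := ⟨0, by rw [Matrix.mul_zero, zero_smul]⟩
      smul_mem' := by
        rintro c a ⟨X, hX⟩
        exact ⟨c • X, by rw [Matrix.mul_smul, hX, smul_smul, smul_eq_mul]⟩ }
  have key : ∀ p : ℕ, p.Prime → ∃ d ∈ I, ¬ (p : ℤ) ∣ d := by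
    intro p hp
    have := Fact.mk hp
    have hsurj : Function.Surjective (W.map (Int.castRingHom (ZMod p))).mulVec := by
      have : LinearMap.range (W.map (Int.castRingHom (ZMod p))).mulVecLin = ⊤ := by
        apply Submodule.eq_top_of_finrank_eq
        rw [Module.finrank_fintype_fun_eq_card]
        exact hW p hp
      exact LinearMap.range_eq_top.1 this
    obtain ⟨Y, hY⟩ := mulVec_surjective_iff_exists_right_inverse.1 hsurj
    choose x hx using fun i j => ZMod.intCast_surjective (Y i j)
    have hxY : (Matrix.of x).map (Int.castRingHom (ZMod p)) = Y := by
      ext i j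
      exact hx i j
    refine ⟨(W * Matrix.of x).det, ⟨Matrix.of x * (W * Matrix.of x).adjugate, ?_⟩, ?_⟩
    · rw [← Matrix.mul_assoc, mul_adjugate]
    · rw [← ZMod.intCast_zmod_eq_zero_iff_dvd _ p]
      have := (Int.castRingHom (ZMod p)).map_det (W * Matrix.of x)
      rw [RingHom.mapMatrix_apply, Matrix.map_mul, hxY, hY, det_one] at this
      rw [eq_intCast] at this
      rw [this]
      exact one_ne_zero
  suffices h : (1 : ℤ) ∈ I by
    obtain ⟨X, hX⟩ := h
    exact ⟨X, by rw [hX, one_smul]⟩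
  rw [← Ideal.eq_top_iff_one]
  by_contra hI
  obtain ⟨g, hg⟩ := IsPrincipalIdealRing.principal I
  have hg' : I = Ideal.span {g} := hg
  have hu : g.natAbs ≠ 1 := fun h =>
    hI (by rw [hg', Ideal.span_singleton_eq_top]; exact Int.isUnit_iff_natAbs_eq.2 h)
  obtain ⟨p, hp, hpg⟩ := Nat.exists_prime_and_dvd hu
  obtain ⟨d, hd, hpd⟩ := key p hp
  rw [hg', Ideal.mem_span_singleton] at hd
  exact hpd ((Int.natCast_dvd.2 hpg).trans hd)

section Completion

variable {R : Type*} [CommRing R]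

/-- A matrix with bottom rows `W`, symplectic when `W` is isotropic with right inverse `X`. -/
def symplecticCompletion (W : Matrix (Fin 2) (Fin 2 ⊕ Fin 2) R)
    (X : Matrix (Fin 2 ⊕ Fin 2) (Fin 2) R) : Matrix (Fin 2 ⊕ Fin 2) (Fin 2 ⊕ Fin 2) R :=
  fromRows (Xᵀ * J (Fin 2) R + !![0, -(Xᵀ * J (Fin 2) R * X) 0 1; 0, 0] * W) W

theorem symplecticCompletion_map {R' : Type*} [CommRing R'] (f : R →+* R')
    (W : Matrix (Fin 2) (Fin 2 ⊕ Fin 2) R) (X : Matrix (Fin 2 ⊕ Fin 2) (Fin 2) R) :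
    (symplecticCompletion W X).map f = symplecticCompletion (W.map f) (X.map f) := by
  have h : (Xᵀ * J (Fin 2) R * X).map f = (X.map f)ᵀ * J (Fin 2) R' * X.map f := by
    rw [Matrix.map_mul, Matrix.map_mul, map_J, transpose_map]
  have h01 : f ((Xᵀ * J (Fin 2) R * X) 0 1) = ((X.map f)ᵀ * J (Fin 2) R' * X.map f) 0 1 := by
    rw [← h, map_apply]
  rw [symplecticCompletion, symplecticCompletion, fromRows_map, Matrix.map_add _ (map_add f),
    Matrix.map_mul, Matrix.map_mul, map_J, transpose_map, ← h01]
  congr 3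
  ext i j
  fin_cases i <;> fin_cases j <;> simp

theorem symplecticCompletion_mem {W : Matrix (Fin 2) (Fin 2 ⊕ Fin 2) R}
    {X : Matrix (Fin 2 ⊕ Fin 2) (Fin 2) R} (hW : W * J (Fin 2) R * Wᵀ = 0) (hX : W * X = 1) :
    symplecticCompletion W X ∈ symplecticGroup (Fin 2) R := by
  set K := Xᵀ * J (Fin 2) R * X with hK
  set S : Matrix (Fin 2) (Fin 2) R := !![0, -K 0 1; 0, 0] with hS
  have hJJ := J_squared (Fin 2) R
  have hX' : Xᵀ * Wᵀ = 1 := by rw [← transpose_mul, hX, transpose_one]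
  have hKalt : K + S - Sᵀ = 0 := by
    have hentry : ∀ i j, K i j = X (Sum.inr 0) i * X (Sum.inl 0) j +
        X (Sum.inr 1) i * X (Sum.inl 1) j - X (Sum.inl 0) i * X (Sum.inr 0) j -
        X (Sum.inl 1) i * X (Sum.inr 1) j := by
      intro i j
      simp [hK, J, Matrix.mul_apply, Fintype.sum_sum_type, Fin.sum_univ_two, fromBlocks, one_apply]
      ring
    ext i j
    fin_cases i <;> fin_cases j <;> simp [hS, hentry] <;> ring
  rw [SymplecticGroup.mem_iff, symplecticCompletion, ← hK, ← hS]
  set T := Xᵀ * J (Fin 2) R + S * W with hT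
  have hTW : T * J (Fin 2) R * Wᵀ = -1 := by
    rw [hT, Matrix.add_mul, Matrix.add_mul, Matrix.mul_assoc Xᵀ, hJJ,
      show S * W * J (Fin 2) R * Wᵀ = S * (W * J (Fin 2) R * Wᵀ) by simp only [Matrix.mul_assoc],
      hW, Matrix.mul_zero, add_zero, Matrix.mul_neg, Matrix.mul_one, Matrix.neg_mul, hX']
  have hWT : W * J (Fin 2) R * Tᵀ = 1 := by
    have := congrArg transpose hTW
    simpa [transpose_mul, Matrix.mul_assoc] using this
  have hTT : T * J (Fin 2) R * Tᵀ = 0 := by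
    have h1 : T * J (Fin 2) R * Tᵀ = Xᵀ * J (Fin 2) R * J (Fin 2) R * Tᵀ + S := by
      conv_lhs => rw [hT]
      rw [Matrix.add_mul, Matrix.add_mul,
        show S * W * J (Fin 2) R * Tᵀ = S * (W * J (Fin 2) R * Tᵀ) by simp only [Matrix.mul_assoc],
        hWT, Matrix.mul_one]
    rw [h1, Matrix.mul_assoc Xᵀ, hJJ, Matrix.mul_neg, Matrix.mul_one, Matrix.neg_mul, hT,
      transpose_add, transpose_mul, transpose_mul, transpose_transpose, J_transpose,
      Matrix.mul_add, ← Matrix.mul_assoc Xᵀ Wᵀ, hX', Matrix.one_mul, ← hKalt, hK]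
    simp only [Matrix.neg_mul, Matrix.mul_neg, Matrix.mul_assoc]
    abel
  rw [fromRows_mul, transpose_fromRows, fromRows_mul_fromCols, hTT, hTW, hWT, hW, J]

end Completion

/-- Isotropic `2 × 4` integer matrices with a right inverse that agree modulo `n` differ by a
symplectic matrix congruent to `1` modulo `n`. -/
theorem exists_symplectic_of_map_eq (n : ℕ) {W W' : Matrix (Fin 2) (Fin 2 ⊕ Fin 2) ℤ}
    (hW : W * J (Fin 2) ℤ * Wᵀ = 0) (hinv : ∃ X : Matrix (Fin 2 ⊕ Fin 2) (Fin 2) ℤ, W * X = 1)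
    (hW' : W' * J (Fin 2) ℤ * W'ᵀ = 0) (hinv' : ∃ X : Matrix (Fin 2 ⊕ Fin 2) (Fin 2) ℤ, W' * X = 1)
    (h : W.map (Int.castRingHom (ZMod n)) = W'.map (Int.castRingHom (ZMod n))) :
    ∃ γ ∈ symplecticGroup (Fin 2) ℤ, γ.map (Int.castRingHom (ZMod n)) = 1 ∧ W * γ = W' := by
  obtain ⟨X, hX⟩ := hinv
  obtain ⟨Y, hY⟩ := hinv'
  set X' := X + Y * (1 - W' * X) with hX'
  have hWX' : W' * X' = 1 := by
    rw [hX', Matrix.mul_add, ← Matrix.mul_assoc, hY, Matrix.one_mul, add_sub_cancel]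
  have hmap : X'.map (Int.castRingHom (ZMod n)) = X.map (Int.castRingHom (ZMod n)) := by
    rw [hX', Matrix.map_add _ (map_add _), Matrix.map_mul, Matrix.map_sub _ (map_sub _),
      Matrix.map_mul, ← h, ← Matrix.map_mul, hX, sub_self, Matrix.mul_zero, add_zero]
  let g : symplecticGroup (Fin 2) ℤ := ⟨symplecticCompletion W X, symplecticCompletion_mem hW hX⟩
  let g' : symplecticGroup (Fin 2) ℤ := ⟨symplecticCompletion W' X', symplecticCompletion_mem hW' hWX'⟩
  have hgg : (g : Matrix (Fin 2 ⊕ Fin 2) (Fin 2 ⊕ Fin 2) ℤ).map (Int.castRingHom (ZMod n)) =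
      (g' : Matrix (Fin 2 ⊕ Fin 2) (Fin 2 ⊕ Fin 2) ℤ).map (Int.castRingHom (ZMod n)) := by
    simp only [g, g', symplecticCompletion_map, h, hmap]
  refine ⟨(g⁻¹ * g' : symplecticGroup (Fin 2) ℤ), Subtype.property _, ?_, ?_⟩
  · rw [Submonoid.coe_mul, Matrix.map_mul, ← hgg, ← Matrix.map_mul, ← Submonoid.coe_mul,
      inv_mul_cancel, Submonoid.coe_one, Matrix.map_one _ (map_zero _) (map_one _)]
  · have h1 : (g : Matrix (Fin 2 ⊕ Fin 2) (Fin 2 ⊕ Fin 2) ℤ) *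
        (g⁻¹ * g' : symplecticGroup (Fin 2) ℤ) = g' := by
      rw [← Submonoid.coe_mul, mul_inv_cancel_left]
    simp only [g, g', symplecticCompletion, fromRows_mul] at h1
    exact (fromRows_inj h1).2

theorem isSp4_iff_mem_symplecticGroup (γ : Matrix (Fin 2 ⊕ Fin 2) (Fin 2 ⊕ Fin 2) ℤ) :
    IsSp4 γ ↔ γ ∈ symplecticGroup (Fin 2) ℤ := by
  have hJ : Jmat = -J (Fin 2) ℤ := by simp [Jmat, J, fromBlocks_neg]
  rw [IsSp4, SymplecticGroup.mem_iff', hJ, Matrix.mul_neg, Matrix.neg_mul, neg_inj]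

/-- Elements of the Siegel parabolic modulo `n` lift to integral symplectic matrices. -/
theorem exists_symplectic_map_eq_fromBlocks {n : ℕ} (hn : n ≠ 0)
    {A D S : Matrix (Fin 2) (Fin 2) (ZMod n)} (hAD : Aᵀ * D = 1) (hS : Sᵀ = S) :
    ∃ γ ∈ symplecticGroup (Fin 2) ℤ,
      γ.map (Int.castRingHom (ZMod n)) = fromBlocks A (A * S) 0 D := by
  have had : A.det * D.det = 1 := by
    rw [← det_transpose A, ← det_mul, hAD, det_one]
  set a := A.det
  set d := D.det
  obtain ⟨H, hH, hHmap⟩ := exists_det_eq_one_map_eq hn !![a, 0; 0, d] (by simpa using had)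
  have hA₁ : (!![d, 0; 0, 1] * A).det = 1 := by
    rw [det_mul, det_fin_two_of, mul_one, mul_zero, sub_zero, mul_comm, had]
  obtain ⟨G, hG, hGmap⟩ := exists_det_eq_one_map_eq hn _ hA₁
  have hHe : ∀ i j, (H i j : ZMod n) = !![a, 0; 0, d] i j := fun i j => by
    rw [← hHmap, map_apply, eq_intCast]
  obtain ⟨T, hT, hTmap⟩ : ∃ T : Matrix (Fin 2) (Fin 2) ℤ, Tᵀ = T ∧
      T.map (Int.castRingHom (ZMod n)) = S := by
    choose s hs using fun i j => ZMod.intCast_surjective (S i j)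
    have h10 : S 1 0 = S 0 1 := congrFun (congrFun hS 0) 1
    refine ⟨!![s 0 0, s 0 1; s 0 1, s 1 1], ?_, ?_⟩ <;>
    · ext i j
      fin_cases i <;> fin_cases j <;> simp [hs, h10]
  refine ⟨fromBlocks !![H 0 0, 0; 0, 1] !![H 0 1, 0; 0, 0] !![H 1 0, 0; 0, 0] !![H 1 1, 0; 0, 1] *
    (fromBlocks G 0 0 G.adjugateᵀ * fromBlocks 1 T 0 1),
    mul_mem ?_ (mul_mem ?_ ?_), ?_⟩
  · rw [det_fin_two] at hH
    refine SymplecticGroup.fromBlocks_mem_iff.2 ⟨?_, ?_, ?_⟩ <;>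
    · ext i j
      fin_cases i <;> fin_cases j <;> simp [Matrix.mul_apply, Fin.sum_univ_two] <;> linarith
  · refine SymplecticGroup.fromBlocks_mem_iff.2 ⟨by simp, by simp, ?_⟩
    rw [← transpose_mul, adjugate_mul, hG]
    simp
  · exact SymplecticGroup.fromBlocks_mem_iff.2 ⟨by simp, by simp [hT], by simp⟩
  · have h11 : (!![H 0 0, 0; 0, 1] : Matrix (Fin 2) (Fin 2) ℤ).map (Int.castRingHom (ZMod n)) =
        !![a, 0; 0, 1] := by
      ext i j; fin_cases i <;> fin_cases j <;> simp [hHe]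
    have h12 : (!![H 0 1, 0; 0, 0] : Matrix (Fin 2) (Fin 2) ℤ).map (Int.castRingHom (ZMod n)) =
        0 := by
      ext i j; fin_cases i <;> fin_cases j <;> simp [hHe]
    have h21 : (!![H 1 0, 0; 0, 0] : Matrix (Fin 2) (Fin 2) ℤ).map (Int.castRingHom (ZMod n)) =
        0 := by
      ext i j; fin_cases i <;> fin_cases j <;> simp [hHe]
    have h22 : (!![H 1 1, 0; 0, 1] : Matrix (Fin 2) (Fin 2) ℤ).map (Int.castRingHom (ZMod n)) =
        !![d, 0; 0, 1] := by
      ext i j; fin_cases i <;> fin_cases j <;> simp [hHe]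
    have hcancel : !![a, 0; 0, 1] * (!![d, 0; 0, 1] * A) = A := by
      rw [← Matrix.mul_assoc, show !![a, 0; 0, 1] * !![d, 0; 0, 1] = 1 by
        rw [Matrix.one_fin_two]; simp [had], Matrix.one_mul]
    have hadj : G.adjugateᵀ.map (Int.castRingHom (ZMod n)) = (!![d, 0; 0, 1] * A).adjugateᵀ := by
      rw [transpose_map, ← hGmap]
      exact congrArg transpose ((Int.castRingHom (ZMod n)).map_adjugate G)
    have hD : !![d, 0; 0, 1] * (!![d, 0; 0, 1] * A).adjugateᵀ = D := by
      have h1 : Aᵀ * (!![d, 0; 0, 1] * (!![d, 0; 0, 1] * A).adjugateᵀ) = 1 := by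
        have h2 : Aᵀ * !![d, 0; 0, 1] = (!![d, 0; 0, 1] * A)ᵀ := by
          rw [transpose_mul]
          congr 1
          ext i j; fin_cases i <;> fin_cases j <;> simp
        rw [← Matrix.mul_assoc, h2, ← transpose_mul, adjugate_mul, hA₁, one_smul, transpose_one]
      calc _ = D * Aᵀ * (!![d, 0; 0, 1] * (!![d, 0; 0, 1] * A).adjugateᵀ) := by
            rw [mul_eq_one_comm.1 hAD, Matrix.one_mul]
        _ = D := by rw [Matrix.mul_assoc, h1, Matrix.mul_one]
    rw [Matrix.map_mul, Matrix.map_mul, fromBlocks_map, fromBlocks_map, fromBlocks_map, h11, h12,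
      h21, h22, hGmap, hTmap, hadj, Matrix.map_zero _ (map_zero _),
      Matrix.map_one _ (map_zero _) (map_one _), fromBlocks_multiply, fromBlocks_multiply]
    simp only [Matrix.mul_one, Matrix.mul_zero, Matrix.zero_mul, add_zero, zero_add, hD, hcancel,
      ← Matrix.mul_assoc !![a, 0; 0, 1]]

theorem SameOrbit.of_symplectic {L : ℕ} {M N M' N' G : Matrix (Fin 2) (Fin 2) ℤ}
    {γ : Matrix (Fin 2 ⊕ Fin 2) (Fin 2 ⊕ Fin 2) ℤ} (hγ : γ ∈ symplecticGroup (Fin 2) ℤ)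
    (hγL : (γ.map (Int.castRingHom (ZMod L))).toBlocks₂₁ = 0) (hG : IsUnit G.det)
    (h : G * (fromCols M N * γ) = fromCols M' N') : SameOrbit L M N M' N' := by
  refine ⟨γ, ⟨(isSp4_iff_mem_symplecticGroup γ).2 hγ, fun i j => ?_⟩, G, hG, ?_⟩
  · rw [← ZMod.intCast_zmod_eq_zero_iff_dvd _ L]
    exact congrFun (congrFun hγL i) j
  · rw [← fromBlocks_toBlocks γ, fromCols_mul_fromBlocks, mul_fromCols] at h
    obtain ⟨h1, h2⟩ := fromCols_inj h
    exact ⟨h1.symm, h2.symm⟩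

theorem bijective_ringHom_zmod_of_coprime {ι : Type*} [Fintype ι] (a : ι → ℕ)
    (ha : Pairwise (Function.onFun Nat.Coprime a)) {n : ℕ} (hn : n = ∏ i, a i)
    (f : ∀ i, ZMod n →+* ZMod (a i)) : Function.Bijective fun r i => f i r := by
  subst hn
  have : (fun r i => f i r) = ZMod.prodEquivPi a ha := by
    funext r i
    rw [ZMod.prodEquivPi_apply]
    exact RingHom.congr_fun (Subsingleton.elim _ _) r
  rw [this]
  exact (ZMod.prodEquivPi a ha).bijective

namespace IsCSPair

variable {M N : Matrix (Fin 2) (Fin 2) ℤ}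

theorem isotropic (h : IsCSPair M N) :
    fromCols M N * J (Fin 2) ℤ * (fromCols M N)ᵀ = 0 := by
  rw [J, fromCols_mul_fromBlocks, transpose_fromCols, fromCols_mul_fromRows]
  simp [h.1]

theorem exists_mul_eq_one (h : IsCSPair M N) :
    ∃ X : Matrix (Fin 2 ⊕ Fin 2) (Fin 2) ℤ, fromCols M N * X = 1 := by
  refine exists_mul_eq_one_of_rank_map _ fun p hp => ?_
  rw [Fintype.card_fin]
  refine Eq.trans (congrArg rank ?_) (h.2 p hp)
  ext i j
  rcases j with j | j <;> simp [concatMod]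

theorem map_transpose_comm (h : IsCSPair M N) {R : Type*} [CommRing R] (f : ℤ →+* R) :
    M.map f * (N.map f)ᵀ = N.map f * (M.map f)ᵀ := by
  rw [← transpose_map, ← transpose_map, ← Matrix.map_mul, ← Matrix.map_mul, h.1]

theorem exists_map_mul_add_eq_one (h : IsCSPair M N) {R : Type*} [CommRing R] (f : ℤ →+* R) :
    ∃ X Y, M.map f * X + N.map f * Y = 1 := by
  obtain ⟨X, hX⟩ := h.exists_mul_eq_one
  rw [← fromRows_toRows X, fromCols_mul_fromRows] at hX
  refine ⟨X.toRows₁.map f, X.toRows₂.map f, ?_⟩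
  rw [← Matrix.map_mul, ← Matrix.map_mul, ← Matrix.map_add _ (map_add f), hX,
    Matrix.map_one _ (map_zero f) (map_one f)]

theorem of_isDiag (h : M.IsDiag) : IsCSPair M 1 := by
  refine ⟨by rw [transpose_one, Matrix.mul_one, Matrix.one_mul, h.isSymm], fun p hp => ?_⟩
  have := Fact.mk hp
  have hW : concatMod p M 1 *
      (fromRows 0 1 : Matrix (Fin 2 ⊕ Fin 2) (Fin 2) (ZMod p)) = 1 := by
    have : concatMod p M 1 = fromCols (M.map (Int.castRingHom (ZMod p))) 1 := by
      ext i j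
      rcases j with j | j
      · simp [concatMod]
      · simp [concatMod, one_apply]
    rw [this, fromCols_mul_fromRows, Matrix.mul_zero, Matrix.mul_one, zero_add]
  apply le_antisymm
  · simpa using rank_le_card_height (concatMod p M 1)
  · have := rank_mul_le_left (concatMod p M 1)
      (fromRows 0 1 : Matrix (Fin 2 ⊕ Fin 2) (Fin 2) (ZMod p))
    rwa [hW, rank_one, Fintype.card_fin] at this

end IsCSPair

theorem SameOrbit.rank_map_eq {L q : ℕ} [Fact q.Prime] (hq : q ∣ L)
    {M N M' N' : Matrix (Fin 2) (Fin 2) ℤ} (h : SameOrbit L M N M' N') :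
    (M.map (Int.castRingHom (ZMod q))).rank = (M'.map (Int.castRingHom (ZMod q))).rank := by
  obtain ⟨γ, ⟨hγ, hγL⟩, G, hG, hM, -⟩ := h
  rw [isSp4_iff_mem_symplecticGroup, ← fromBlocks_toBlocks γ,
    SymplecticGroup.fromBlocks_mem_iff] at hγ
  set f := Int.castRingHom (ZMod q)
  have hC : γ.toBlocks₂₁.map f = 0 := by
    ext i j
    exact (ZMod.intCast_zmod_eq_zero_iff_dvd _ q).2 ((Int.natCast_dvd_natCast.2 hq).trans (hγL i j))
  have hA : IsUnit (γ.toBlocks₁₁.map f).det := by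
    have h1 := congrArg (fun X => X.map f) hγ.2.2
    simp only [Matrix.map_sub _ (map_sub f), Matrix.map_mul, transpose_map, hC, transpose_zero,
      Matrix.zero_mul, sub_zero, Matrix.map_one _ (map_zero f) (map_one f)] at h1
    have h2 := congrArg det h1
    rw [det_mul, det_transpose, det_one] at h2
    exact IsUnit.of_mul_eq_one _ h2
  have hG' : IsUnit (G.map f).det := by
    have := hG.map f
    rwa [f.map_det] at this
  rw [hM, Matrix.map_mul, Matrix.map_add _ (map_add f), Matrix.map_mul, Matrix.map_mul, hC,
    Matrix.mul_zero, add_zero, rank_mul_eq_right_of_isUnit_det _ _ hG',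
    rank_mul_eq_left_of_isUnit_det _ _ hA]

theorem SameOrbit.of_rank_map_eq {L : ℕ} (hL : Squarefree L)
    {M N M' N' : Matrix (Fin 2) (Fin 2) ℤ} (h : IsCSPair M N) (h' : IsCSPair M' N')
    (hrank : ∀ q : ℕ, q.Prime → q ∣ L → (M.map (Int.castRingHom (ZMod q))).rank =
      (M'.map (Int.castRingHom (ZMod q))).rank) :
    SameOrbit L M N M' N' := by
  set f := Int.castRingHom (ZMod L)
  have hrel : ParabolicRel (M.map f) (N.map f) (M'.map f) (N'.map f) := by
    let c : ∀ q : L.primeFactors, ZMod L →+* ZMod (q : ℕ) := fun q =>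
      ZMod.castHom (Nat.dvd_of_mem_primeFactors q.2) _
    refine ParabolicRel.of_forall_map c (bijective_ringHom_zmod_of_coprime _ ?_ ?_ c) fun q => ?_
    · intro q r hqr
      exact (Nat.coprime_primes (Nat.prime_of_mem_primeFactors q.2)
        (Nat.prime_of_mem_primeFactors r.2)).2 fun hne => hqr (Subtype.ext hne)
    · rw [Finset.prod_coe_sort L.primeFactors (fun q => q), Nat.prod_primeFactors_of_squarefree hL]
    · have hq := Nat.prime_of_mem_primeFactors q.2
      have := Fact.mk hq
      have hmap : ∀ X : Matrix (Fin 2) (Fin 2) ℤ,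
          (X.map f).map (c q) = X.map (Int.castRingHom (ZMod q)) := by
        intro X
        ext i j
        simp [f]
      simp only [hmap]
      exact ParabolicRel.of_rank_eq (h.map_transpose_comm _) (h.exists_map_mul_add_eq_one _)
        (h'.map_transpose_comm _) (h'.exists_map_mul_add_eq_one _)
        (hrank q hq (Nat.dvd_of_mem_primeFactors q.2))
  obtain ⟨g, A, D, S, hg, hAD, hS, hM, hN⟩ := hrel
  obtain ⟨G, hG, hGmap⟩ := exists_det_eq_one_map_eq hL.ne_zero g hg
  obtain ⟨γ, hγ, hγmap⟩ := exists_symplectic_map_eq_fromBlocks hL.ne_zero hAD hS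
  have hGG : G * G.adjugate = 1 := by rw [mul_adjugate, hG, one_smul]
  set W := fromCols M N
  have hW₁ : G * (W * γ) * J (Fin 2) ℤ * (G * (W * γ))ᵀ = 0 := by
    calc _ = G * (W * (γ * J (Fin 2) ℤ * γᵀ) * Wᵀ) * Gᵀ := by
          simp only [transpose_mul, Matrix.mul_assoc]
      _ = 0 := by
          rw [SymplecticGroup.mem_iff.1 hγ, h.isotropic, Matrix.mul_zero, Matrix.zero_mul]
  have hinv₁ : ∃ X : Matrix (Fin 2 ⊕ Fin 2) (Fin 2) ℤ, G * (W * γ) * X = 1 := by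
    obtain ⟨X, hX⟩ := h.exists_mul_eq_one
    have hγγ : γ * ((⟨γ, hγ⟩ : symplecticGroup (Fin 2) ℤ)⁻¹ : symplecticGroup (Fin 2) ℤ) = 1 :=
      congrArg Subtype.val (mul_inv_cancel (⟨γ, hγ⟩ : symplecticGroup (Fin 2) ℤ))
    generalize (((⟨γ, hγ⟩ : symplecticGroup (Fin 2) ℤ)⁻¹ : symplecticGroup (Fin 2) ℤ) :
      Matrix (Fin 2 ⊕ Fin 2) (Fin 2 ⊕ Fin 2) ℤ) = δ at hγγ
    refine ⟨δ * X * G.adjugate, ?_⟩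
    rw [show G * (W * γ) * (δ * X * G.adjugate) = G * (W * (γ * δ) * X) * G.adjugate by
      simp only [Matrix.mul_assoc], hγγ, Matrix.mul_one, hX, Matrix.mul_one, hGG]
  have hmap : (G * (W * γ)).map f = (fromCols M' N').map f := by
    rw [Matrix.map_mul, Matrix.map_mul, hGmap, hγmap, fromCols_map, fromCols_map,
      fromCols_mul_fromBlocks, mul_fromCols, hN, hM]
    simp only [Matrix.mul_zero, add_zero, Matrix.mul_add, Matrix.mul_assoc]
  obtain ⟨δ, hδ, hδmap, hδW⟩ :=
    exists_symplectic_of_map_eq L hW₁ hinv₁ h'.isotropic h'.exists_mul_eq_one hmap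
  refine SameOrbit.of_symplectic (mul_mem hγ hδ) (G := G) ?_ (by rw [hG]; exact isUnit_one) ?_
  · rw [Matrix.map_mul, hγmap, hδmap, Matrix.mul_one, toBlocks_fromBlocks₂₁]
  · rw [← hδW]
    simp only [Matrix.mul_assoc, W]

theorem sameOrbit_iff_rank_map_eq {L : ℕ} (hL : Squarefree L)
    {M N M' N' : Matrix (Fin 2) (Fin 2) ℤ} (h : IsCSPair M N) (h' : IsCSPair M' N') :
    SameOrbit L M N M' N' ↔ ∀ q : ℕ, q.Prime → q ∣ L →
      (M.map (Int.cast : ℤ → ZMod q)).rank = (M'.map (Int.cast : ℤ → ZMod q)).rank :=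
  ⟨fun ho _ hq hqL => have := Fact.mk hq; ho.rank_map_eq hqL, SameOrbit.of_rank_map_eq hL h h'⟩

namespace IsPartitionMatrix

variable {N₀ N₁ N₂ q : ℕ} {M : Matrix (Fin 2) (Fin 2) ℤ}

theorem rank_map_of_dvd_left [Fact q.Prime] (h : IsPartitionMatrix N₀ N₁ N₂ M) (hq : q ∣ N₀) :
    (M.map (Int.cast : ℤ → ZMod q)).rank = 0 := by
  have : M.map (Int.cast : ℤ → ZMod q) = 0 := by
    ext i j
    exact (ZMod.intCast_zmod_eq_zero_iff_dvd _ q).2 (h.2.1 q Fact.out hq i j)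
  rw [this, rank_zero]

theorem rank_map_of_dvd_middle [Fact q.Prime] (h : IsPartitionMatrix N₀ N₁ N₂ M) (hq : q ∣ N₁) :
    (M.map (Int.cast : ℤ → ZMod q)).rank = 1 := by
  have : M.map (Int.cast : ℤ → ZMod q) = !![1, 0; 0, 0] := by
    ext i j
    have := (ZMod.intCast_zmod_eq_zero_iff_dvd _ q).2 (h.2.2.1 q Fact.out hq i j)
    rw [Matrix.sub_apply, Int.cast_sub, sub_eq_zero] at this
    rw [map_apply, this]
    fin_cases i <;> fin_cases j <;> simp
  rw [this, ParabolicRel.rank_diag_one_zero]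

theorem rank_map_of_dvd_right [Fact q.Prime] (h : IsPartitionMatrix N₀ N₁ N₂ M) (hq : q ∣ N₂) :
    (M.map (Int.cast : ℤ → ZMod q)).rank = 2 := by
  have : M.map (Int.cast : ℤ → ZMod q) = 1 := by
    ext i j
    have := (ZMod.intCast_zmod_eq_zero_iff_dvd _ q).2 (h.2.2.2 q Fact.out hq i j)
    rw [Matrix.sub_apply, Int.cast_sub, sub_eq_zero] at this
    rw [map_apply, this]
    fin_cases i <;> fin_cases j <;> simp
  rw [this, rank_one, Fintype.card_fin]

/-- The reduction ranks of a partition matrix determine its partition, up to divisibility. -/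
theorem dvd_of_rank_map_eq {N₀' N₁' N₂' : ℕ} {M' : Matrix (Fin 2) (Fin 2) ℤ}
    (hsq : Squarefree (N₀ * N₁ * N₂)) (hN : N₀ * N₁ * N₂ = N₀' * N₁' * N₂')
    (h : IsPartitionMatrix N₀ N₁ N₂ M) (h' : IsPartitionMatrix N₀' N₁' N₂' M')
    (hrank : ∀ q : ℕ, q.Prime → q ∣ N₀ * N₁ * N₂ →
      (M.map (Int.cast : ℤ → ZMod q)).rank = (M'.map (Int.cast : ℤ → ZMod q)).rank) :
    N₀ ∣ N₀' ∧ N₁ ∣ N₁' ∧ N₂ ∣ N₂' := by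
  have hd₀ : N₀ ∣ N₀ * N₁ * N₂ := Dvd.intro _ (mul_assoc _ _ _).symm
  have hd₁ : N₁ ∣ N₀ * N₁ * N₂ := (Dvd.intro_left _ rfl).mul_right _
  have hd₂ : N₂ ∣ N₀ * N₁ * N₂ := Dvd.intro_left _ rfl
  have key : ∀ q : ℕ, q.Prime → (q ∣ N₀ → q ∣ N₀') ∧ (q ∣ N₁ → q ∣ N₁') ∧ (q ∣ N₂ → q ∣ N₂') := by
    intro q hq
    have := Fact.mk hq
    have hcases : q ∣ N₀ * N₁ * N₂ → q ∣ N₀' ∨ q ∣ N₁' ∨ q ∣ N₂' := fun hd => by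
      rwa [hN, hq.dvd_mul, hq.dvd_mul, or_assoc] at hd
    refine ⟨fun hd => ?_, fun hd => ?_, fun hd => ?_⟩
    · have h1 := hrank q hq (hd.trans hd₀)
      rw [h.rank_map_of_dvd_left hd] at h1
      rcases hcases (hd.trans hd₀) with h2 | h2 | h2
      · exact h2
      · rw [h'.rank_map_of_dvd_middle h2] at h1; omega
      · rw [h'.rank_map_of_dvd_right h2] at h1; omega
    · have h1 := hrank q hq (hd.trans hd₁)
      rw [h.rank_map_of_dvd_middle hd] at h1
      rcases hcases (hd.trans hd₁) with h2 | h2 | h2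
      · rw [h'.rank_map_of_dvd_left h2] at h1; omega
      · exact h2
      · rw [h'.rank_map_of_dvd_right h2] at h1; omega
    · have h1 := hrank q hq (hd.trans hd₂)
      rw [h.rank_map_of_dvd_right hd] at h1
      rcases hcases (hd.trans hd₂) with h2 | h2 | h2
      · rw [h'.rank_map_of_dvd_left h2] at h1; omega
      · rw [h'.rank_map_of_dvd_middle h2] at h1; omega
      · exact h2
  have dvd_of : ∀ {a b : ℕ}, Squarefree a → (∀ q : ℕ, q.Prime → q ∣ a → q ∣ b) → a ∣ b := by
    intro a b ha hab
    rw [← Nat.prod_primeFactors_of_squarefree ha]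
    exact Finset.prod_primes_dvd b (fun q hq => (Nat.prime_of_mem_primeFactors hq).prime)
      fun q hq => hab q (Nat.prime_of_mem_primeFactors hq) (Nat.dvd_of_mem_primeFactors hq)
  exact ⟨dvd_of (hsq.squarefree_of_dvd hd₀) fun q hq => (key q hq).1,
    dvd_of (hsq.squarefree_of_dvd hd₁) fun q hq => (key q hq).2.1,
    dvd_of (hsq.squarefree_of_dvd hd₂) fun q hq => (key q hq).2.2⟩

end IsPartitionMatrix

theorem stmt12 (L : ℕ) (hL : Squarefree L) :
    (∀ N₀ N₁ N₂ N₀' N₁' N₂' : ℕ, ∀ Mρ Mρ' : Matrix (Fin 2) (Fin 2) ℤ,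
      N₀ * N₁ * N₂ = L → N₀' * N₁' * N₂' = L →
      IsPartitionMatrix N₀ N₁ N₂ Mρ → IsPartitionMatrix N₀' N₁' N₂' Mρ' →
      (SameOrbit L Mρ 1 Mρ' 1 ↔ (N₀ = N₀' ∧ N₁ = N₁' ∧ N₂ = N₂'))) ∧
    (∀ M N M' N' : Matrix (Fin 2) (Fin 2) ℤ,
      IsCSPair M N → IsCSPair M' N' →
      (SameOrbit L M N M' N' ↔
        ∀ q : ℕ, q.Prime → q ∣ L →
          (M.map (Int.cast : ℤ → ZMod q)).rank
            = (M'.map (Int.cast : ℤ → ZMod q)).rank)) := by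
  have hiff : ∀ M N M' N' : Matrix (Fin 2) (Fin 2) ℤ, IsCSPair M N → IsCSPair M' N' →
      (SameOrbit L M N M' N' ↔ ∀ q : ℕ, q.Prime → q ∣ L →
        (M.map (Int.cast : ℤ → ZMod q)).rank = (M'.map (Int.cast : ℤ → ZMod q)).rank) :=
    fun _ _ _ _ h h' => sameOrbit_iff_rank_map_eq hL h h'
  refine ⟨fun N₀ N₁ N₂ N₀' N₁' N₂' M M' hN hN' h h' => ?_, hiff⟩
  rw [hiff _ _ _ _ (IsCSPair.of_isDiag h.1) (IsCSPair.of_isDiag h'.1)]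
  constructor
  · intro hrank
    obtain ⟨h0, h1, h2⟩ := h.dvd_of_rank_map_eq (hN ▸ hL) (hN.trans hN'.symm) h' (hN ▸ hrank)
    obtain ⟨h0', h1', h2'⟩ := h'.dvd_of_rank_map_eq (hN' ▸ hL) (hN'.trans hN.symm) h
      (hN' ▸ fun q hq hqL => (hrank q hq hqL).symm)
    exact ⟨Nat.dvd_antisymm h0 h0', Nat.dvd_antisymm h1 h1', Nat.dvd_antisymm h2 h2'⟩
  · rintro ⟨rfl, rfl, rfl⟩ q hq hqL
    have := Fact.mk hq
    rw [← hN, hq.dvd_mul, hq.dvd_mul] at hqL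
    rcases hqL with (hd | hd) | hd
    · rw [h.rank_map_of_dvd_left hd, h'.rank_map_of_dvd_left hd]
    · rw [h.rank_map_of_dvd_middle hd, h'.rank_map_of_dvd_middle hd]
    · rw [h.rank_map_of_dvd_right hd, h'.rank_map_of_dvd_right hd]
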